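/- For all b ≥ 1, ρ ∈ (0,1], Δ ≥ 1, q ≥ 2 there exists a constant C = C(b,ρ,Δ,q) > 0 such that the following holds. For every n ≥ 1, every probability measure ν on Σ^n (|Σ| = q) satisfying Assumption A, and every f : Σ^n → {0,1} such that bq·√(I_j(f)) ≤ 1 for every j ∈ [n], we have Var_ν(f) ≤ C · Σ_{j=1}^n I_j(f) / (1 − log(bq·√(I_j(f)))), where terms with I_j(f) = 0 are interpreted as 0. -/

import Mathlib

open scoped Classical BigOperators

noncomputable section

abbrev Cfg (σ : Type) (n : ℕ) : Type := Fin n → σ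

variable {σ : Type} [Fintype σ] [DecidableEq σ] {n : ℕ}

/-- Expectation of `f` under the discrete measure `ν`. -/
def expct (ν f : Cfg σ n → ℝ) : ℝ := ∑ x, ν x * f x

/-- Variance of `f` under `ν`. -/
def varnc (ν f : Cfg σ n → ℝ) : ℝ := expct ν (fun x => (f x - expct ν f) ^ 2)

/-- ν is a fully supported probability measure. -/
def IsProb (ν : Cfg σ n → ℝ) : Prop := (∀ x, 0 < ν x) ∧ ∑ x, ν x = 1

/-- `(P_i f)(x) = E[f(X) | X_j = x_j ∀ j ≠ i]`. -/
def Pop (ν : Cfg σ n → ℝ) (i : Fin n) (f : Cfg σ n → ℝ) (x : Cfg σ n) : ℝ :=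
  (∑ y ∈ Finset.univ.filter (fun y : Cfg σ n => ∀ j, j ≠ i → y j = x j), ν y * f y) /
    (∑ y ∈ Finset.univ.filter (fun y : Cfg σ n => ∀ j, j ≠ i → y j = x j), ν y)

/-- `L_i f = P_i f - f`. -/
def Lop (ν : Cfg σ n → ℝ) (i : Fin n) (f : Cfg σ n → ℝ) (x : Cfg σ n) : ℝ :=
  Pop ν i f x - f x

/-- `‖f‖_p = (E_ν |f|^p)^{1/p}`. -/
def pnorm (ν : Cfg σ n → ℝ) (p : ℝ) (f : Cfg σ n → ℝ) : ℝ :=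
  (∑ x, ν x * |f x| ^ p) ^ (1 / p)

/-- Relative-entropy functional `Ent_ν[g]`. -/
def entFun (ν g : Cfg σ n → ℝ) : ℝ :=
  expct ν (fun x => g x * Real.log (g x)) - expct ν g * Real.log (expct ν g)

/-- The log-Sobolev inequality with constant `ρ` for the Glauber dynamics of `ν`. -/
def LogSobolev (ν : Cfg σ n → ℝ) (ρ : ℝ) : Prop :=
  ∀ g : Cfg σ n → ℝ, (∀ x, 0 ≤ g x) →
    ρ * entFun ν g ≤ 2 * ∑ i : Fin n, expct ν (fun x => (Lop ν i (fun y => Real.sqrt (g y)) x) ^ 2)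

/-- `ν` is `b`-marginally bounded. -/
def MargBounded (ν : Cfg σ n → ℝ) (b : ℝ) : Prop :=
  ∀ x y : Cfg σ n, hammingDist x y = 1 → 1 / b ≤ ν x / ν y ∧ ν x / ν y ≤ b

/-- Conditional probability `Pr[X_i = a | X_j = x_j ∀ j ≠ i]`. -/
def condProb (ν : Cfg σ n → ℝ) (i : Fin n) (x : Cfg σ n) (a : σ) : ℝ :=
  ν (Function.update x i a) / ∑ a' : σ, ν (Function.update x i a')

/-- `ν` is a Markov random field w.r.t. `G`: the conditional law of `X_i` given all other
coordinates depends only on the neighbors of `i` in `G`. -/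
def IsMRF (ν : Cfg σ n → ℝ) (G : SimpleGraph (Fin n)) : Prop :=
  ∀ (i : Fin n) (x y : Cfg σ n), (∀ j, G.Adj i j → x j = y j) →
    ∀ a : σ, condProb ν i x a = condProb ν i y a

/-- The graph `G` has maximum degree at most `Δ`. -/
def MaxDegLE {m : ℕ} (G : SimpleGraph (Fin m)) (Δ : ℕ) : Prop :=
  ∀ i, (Finset.univ.filter fun j => G.Adj i j).card ≤ Δ

/-- Assumption A: fully supported probability measure, `b`-marginally bounded,
log-Sobolev with constant `ρ ∈ (0,1]`, and an MRF w.r.t. a graph of max degree `Δ`. -/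
def AssumptionA (ν : Cfg σ n → ℝ) (b ρ : ℝ) (Δ : ℕ) : Prop :=
  IsProb ν ∧ 1 ≤ b ∧ MargBounded ν b ∧ 0 < ρ ∧ ρ ≤ 1 ∧ LogSobolev ν ρ ∧
    ∃ G : SimpleGraph (Fin n), IsMRF ν G ∧ MaxDegLE G Δ

/-- Influence of coordinate `i` on `f`. -/
def influence (ν : Cfg σ n → ℝ) (f : Cfg σ n → ℝ) (i : Fin n) : ℝ :=
  ∑ x ∈ Finset.univ.filter (fun x : Cfg σ n => ∃ a : σ, f (Function.update x i a) ≠ f x), ν x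

set_option linter.unusedSectionVars false

/-! ### Averaging over one coordinate -/

theorem expct_add (ν f g : Cfg σ n → ℝ) :
    expct ν (fun x => f x + g x) = expct ν f + expct ν g := by
  simp [expct, mul_add, Finset.sum_add_distrib]

theorem expct_const_mul (ν f : Cfg σ n → ℝ) (c : ℝ) :
    expct ν (fun x => c * f x) = c * expct ν f := by
  simp only [expct, Finset.mul_sum]
  exact Finset.sum_congr rfl fun x _ => by ring

theorem expct_sum {ι : Type*} (s : Finset ι) (ν : Cfg σ n → ℝ) (f : ι → Cfg σ n → ℝ) :
    expct ν (fun x => ∑ i ∈ s, f i x) = ∑ i ∈ s, expct ν (f i) := by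
  simp only [expct, Finset.mul_sum]
  exact Finset.sum_comm

theorem expct_mono {ν f g : Cfg σ n → ℝ} (hν : IsProb ν) (h : ∀ x, f x ≤ g x) :
    expct ν f ≤ expct ν g :=
  Finset.sum_le_sum fun x _ => mul_le_mul_of_nonneg_left (h x) (hν.1 x).le

theorem expct_nonneg {ν f : Cfg σ n → ℝ} (hν : IsProb ν) (h : ∀ x, 0 ≤ f x) :
    0 ≤ expct ν f :=
  Finset.sum_nonneg fun x _ => mul_nonneg (hν.1 x).le (h x)

theorem expct_const {ν : Cfg σ n → ℝ} (hν : IsProb ν) (c : ℝ) :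
    expct ν (fun _ => c) = c := by
  simp [expct, ← Finset.sum_mul, hν.2]

/-- The configurations that agree with `x` away from the coordinate `i`. -/
def fibre (i : Fin n) (x : Cfg σ n) : Finset (Cfg σ n) :=
  Finset.univ.filter fun y => ∀ j, j ≠ i → y j = x j

theorem mem_fibre {i : Fin n} {x y : Cfg σ n} : y ∈ fibre i x ↔ ∀ j, j ≠ i → y j = x j := by
  simp [fibre]

theorem mem_fibre_comm {i : Fin n} {x y : Cfg σ n} : y ∈ fibre i x ↔ x ∈ fibre i y := by
  simp only [mem_fibre, eq_comm]

theorem fibre_eq {i : Fin n} {x y : Cfg σ n} (h : y ∈ fibre i x) : fibre i y = fibre i x := by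
  ext z
  rw [mem_fibre] at h
  simp only [mem_fibre]
  exact forall₂_congr fun j hj => by rw [h j hj]

theorem Pop_eq (ν : Cfg σ n → ℝ) (i : Fin n) (f : Cfg σ n → ℝ) (x : Cfg σ n) :
    Pop ν i f x = (∑ y ∈ fibre i x, ν y * f y) / ∑ y ∈ fibre i x, ν y := by
  unfold Pop fibre
  congr!

theorem sum_fibre_pos {ν : Cfg σ n → ℝ} (hν : IsProb ν) (i : Fin n) (x : Cfg σ n) :
    0 < ∑ y ∈ fibre i x, ν y :=
  Finset.sum_pos (fun y _ => hν.1 y) ⟨x, by simp [mem_fibre]⟩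

theorem sum_fibre {i : Fin n} (x : Cfg σ n) (g : Cfg σ n → ℝ) :
    ∑ y ∈ fibre i x, g y = ∑ a, g (Function.update x i a) := by
  symm
  refine Finset.sum_bij' (fun a _ => Function.update x i a) (fun y _ => y i) ?_ ?_ ?_ ?_ ?_
  · intro a _
    rw [mem_fibre]
    intro j hj
    simp [hj]
  · simp
  · simp
  · intro y hy
    rw [mem_fibre] at hy
    ext j
    by_cases hj : j = i
    · subst hj; simp
    · simp [hj, hy j hj]
  · simp

theorem Pop_eq_sum_condProb (ν : Cfg σ n → ℝ) (i : Fin n) (f : Cfg σ n → ℝ) (x : Cfg σ n) :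
    Pop ν i f x = ∑ a, condProb ν i x a * f (Function.update x i a) := by
  rw [Pop_eq, sum_fibre, sum_fibre, Finset.sum_div]
  refine Finset.sum_congr rfl fun a _ => ?_
  unfold condProb
  ring

/-- `Pop ν i` as a linear operator. -/
def popLin (ν : Cfg σ n → ℝ) (i : Fin n) : Module.End ℝ (Cfg σ n → ℝ) where
  toFun := Pop ν i
  map_add' f g := by
    ext x
    simp [Pop_eq, mul_add, Finset.sum_add_distrib, add_div]
  map_smul' c f := by
    ext x
    simp only [Pop_eq, Pi.smul_apply, smul_eq_mul, RingHom.id_apply, ← mul_div_assoc,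
      Finset.mul_sum]
    congr 1
    exact Finset.sum_congr rfl fun y _ => by ring

/-- `Lop ν i` as a linear operator. -/
def lopLin (ν : Cfg σ n → ℝ) (i : Fin n) : Module.End ℝ (Cfg σ n → ℝ) := popLin ν i - 1

theorem popLin_apply (ν : Cfg σ n → ℝ) (i : Fin n) (f : Cfg σ n → ℝ) :
    popLin ν i f = Pop ν i f := rfl

theorem lopLin_apply (ν : Cfg σ n → ℝ) (i : Fin n) (f : Cfg σ n → ℝ) :
    lopLin ν i f = Lop ν i f := rfl

theorem Pop_const {ν : Cfg σ n → ℝ} (hν : IsProb ν) (i : Fin n) (c : ℝ) :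
    Pop ν i (fun _ => c) = fun _ => c := by
  ext x
  rw [Pop_eq, ← Finset.sum_mul, mul_div_assoc, mul_div_cancel₀ _ (sum_fibre_pos hν i x).ne']

theorem Pop_mono {ν : Cfg σ n → ℝ} (hν : IsProb ν) (i : Fin n) {f g : Cfg σ n → ℝ}
    (h : ∀ x, f x ≤ g x) (x : Cfg σ n) : Pop ν i f x ≤ Pop ν i g x := by
  rw [Pop_eq, Pop_eq]
  refine div_le_div_of_nonneg_right (Finset.sum_le_sum fun y _ => ?_) (sum_fibre_pos hν i x).le
  exact mul_le_mul_of_nonneg_left (h y) (hν.1 y).le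

theorem abs_Pop_le {ν : Cfg σ n → ℝ} (hν : IsProb ν) (i : Fin n) (f : Cfg σ n → ℝ)
    (x : Cfg σ n) : |Pop ν i f x| ≤ Pop ν i (fun y => |f y|) x := by
  rw [abs_le]
  refine ⟨?_, Pop_mono hν i (fun y => le_abs_self _) x⟩
  have h := Pop_mono hν i (f := -(fun y => |f y|)) (g := f) (fun y => neg_abs_le _) x
  rw [← popLin_apply, map_neg] at h
  exact h

theorem expct_Pop_mul {ν : Cfg σ n → ℝ} (i : Fin n) (f g : Cfg σ n → ℝ) :
    expct ν (fun x => Pop ν i f x * g x) = expct ν (fun x => f x * Pop ν i g x) := by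
  have key : ∀ f g : Cfg σ n → ℝ, expct ν (fun x => Pop ν i f x * g x) =
      ∑ x, ∑ y, if y ∈ fibre i x then ν x * ν y * f y * g x / ∑ z ∈ fibre i x, ν z else 0 := by
    intro f g
    refine Finset.sum_congr rfl fun x _ => ?_
    dsimp only
    rw [Pop_eq, Finset.sum_ite_mem, Finset.univ_inter, Finset.sum_div, Finset.sum_mul,
      Finset.mul_sum]
    exact Finset.sum_congr rfl fun y _ => by ring
  have hcomm : expct ν (fun x => f x * Pop ν i g x) = expct ν (fun x => Pop ν i g x * f x) := by
    simp only [mul_comm]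
  rw [hcomm, key f g, key g f, Finset.sum_comm]
  refine Finset.sum_congr rfl fun x _ => Finset.sum_congr rfl fun y _ => ?_
  by_cases h : y ∈ fibre i x
  · rw [if_pos h, if_pos (mem_fibre_comm.1 h), fibre_eq h]
    ring
  · rw [if_neg h, if_neg (fun h' => h (mem_fibre_comm.1 h'))]

theorem Pop_Pop {ν : Cfg σ n → ℝ} (hν : IsProb ν) (i : Fin n) (f : Cfg σ n → ℝ) :
    Pop ν i (Pop ν i f) = Pop ν i f := by
  ext x
  rw [Pop_eq]
  have h : ∀ y ∈ fibre i x, ν y * Pop ν i f y = ν y * Pop ν i f x := by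
    intro y hy
    rw [Pop_eq ν i f y, Pop_eq ν i f x, fibre_eq hy]
  rw [Finset.sum_congr rfl h, ← Finset.sum_mul, mul_div_right_comm,
    div_self (sum_fibre_pos hν i x).ne', one_mul]

theorem expct_Pop {ν : Cfg σ n → ℝ} (hν : IsProb ν) (i : Fin n) (f : Cfg σ n → ℝ) :
    expct ν (Pop ν i f) = expct ν f := by
  have h := expct_Pop_mul (ν := ν) i f (fun _ => 1)
  rw [Pop_const hν] at h
  simpa using h

/-! ### Norms -/

/-- The squared `L²` norm. -/
def sqNorm (ν f : Cfg σ n → ℝ) : ℝ := expct ν (fun x => f x ^ 2)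

/-- The `L¹` norm. -/
def absNorm (ν f : Cfg σ n → ℝ) : ℝ := expct ν (fun x => |f x|)

/-- The Dirichlet form of the Glauber dynamics. -/
def dirichlet (ν f : Cfg σ n → ℝ) : ℝ := ∑ i, sqNorm ν (Lop ν i f)

theorem sqNorm_nonneg {ν : Cfg σ n → ℝ} (hν : IsProb ν) (f : Cfg σ n → ℝ) : 0 ≤ sqNorm ν f :=
  expct_nonneg hν fun _ => sq_nonneg _

theorem absNorm_nonneg {ν : Cfg σ n → ℝ} (hν : IsProb ν) (f : Cfg σ n → ℝ) : 0 ≤ absNorm ν f :=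
  expct_nonneg hν fun _ => abs_nonneg _

theorem dirichlet_nonneg {ν : Cfg σ n → ℝ} (hν : IsProb ν) (f : Cfg σ n → ℝ) :
    0 ≤ dirichlet ν f :=
  Finset.sum_nonneg fun _ _ => sqNorm_nonneg hν _

theorem absNorm_add_le {ν : Cfg σ n → ℝ} (hν : IsProb ν) (f g : Cfg σ n → ℝ) :
    absNorm ν (f + g) ≤ absNorm ν f + absNorm ν g := by
  unfold absNorm
  rw [← expct_add]
  exact expct_mono hν fun x => abs_add_le _ _

theorem absNorm_smul (ν : Cfg σ n → ℝ) (c : ℝ) (f : Cfg σ n → ℝ) :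
    absNorm ν (c • f) = |c| * absNorm ν f := by
  unfold absNorm
  rw [← expct_const_mul]
  simp [abs_mul]

theorem absNorm_sub_le {ν : Cfg σ n → ℝ} (hν : IsProb ν) (f g : Cfg σ n → ℝ) :
    absNorm ν (f - g) ≤ absNorm ν f + absNorm ν g := by
  unfold absNorm
  rw [← expct_add]
  exact expct_mono hν fun x => abs_sub _ _

theorem absNorm_sum_le {ι : Type*} {ν : Cfg σ n → ℝ} (hν : IsProb ν) (s : Finset ι)
    (f : ι → Cfg σ n → ℝ) : absNorm ν (∑ i ∈ s, f i) ≤ ∑ i ∈ s, absNorm ν (f i) := by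
  unfold absNorm
  rw [← expct_sum]
  refine expct_mono hν fun x => ?_
  rw [Finset.sum_apply]
  exact Finset.abs_sum_le_sum_abs _ _

theorem sqNorm_sub_le {ν : Cfg σ n → ℝ} (hν : IsProb ν) (f g : Cfg σ n → ℝ) :
    sqNorm ν (f - g) ≤ 2 * (sqNorm ν f + sqNorm ν g) := by
  unfold sqNorm
  rw [← expct_add, ← expct_const_mul]
  refine expct_mono hν fun x => ?_
  simp only [Pi.sub_apply]
  nlinarith [sq_nonneg (f x + g x)]

theorem sqNorm_smul (ν : Cfg σ n → ℝ) (c : ℝ) (f : Cfg σ n → ℝ) :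
    sqNorm ν (c • f) = c ^ 2 * sqNorm ν f := by
  unfold sqNorm
  rw [← expct_const_mul]
  simp [mul_pow]

theorem sqNorm_sum_le {ι : Type*} {ν : Cfg σ n → ℝ} (hν : IsProb ν) (s : Finset ι)
    (f : ι → Cfg σ n → ℝ) :
    sqNorm ν (∑ i ∈ s, f i) ≤ s.card * ∑ i ∈ s, sqNorm ν (f i) := by
  unfold sqNorm
  rw [← expct_sum, ← expct_const_mul]
  refine expct_mono hν fun x => ?_
  rw [Finset.sum_apply]
  exact sq_sum_le_card_mul_sum_sq

theorem sqNorm_add_smul_le {ν : Cfg σ n → ℝ} (hν : IsProb ν) (f g : Cfg σ n → ℝ) {ε : ℝ}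
    (h0 : 0 ≤ ε) (h1 : ε ≤ 1) :
    sqNorm ν (f + ε • g) ≤ sqNorm ν f + ε * (sqNorm ν f + 2 * sqNorm ν g) := by
  unfold sqNorm
  rw [← expct_const_mul, ← expct_add, ← expct_const_mul, ← expct_add]
  refine expct_mono hν fun x => ?_
  simp only [Pi.add_apply, Pi.smul_apply, smul_eq_mul]
  nlinarith [mul_nonneg h0 (sq_nonneg (f x - g x)),
    mul_nonneg (mul_nonneg h0 (sub_nonneg.2 h1)) (sq_nonneg (g x))]

theorem expct_mul_Pop_self {ν : Cfg σ n → ℝ} (hν : IsProb ν) (i : Fin n) (f : Cfg σ n → ℝ) :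
    expct ν (fun x => f x * Pop ν i f x) = sqNorm ν (Pop ν i f) := by
  have h := expct_Pop_mul (ν := ν) i f (Pop ν i f)
  rw [Pop_Pop hν] at h
  rw [← h]
  simp only [sqNorm, sq]

theorem sqNorm_Lop {ν : Cfg σ n → ℝ} (hν : IsProb ν) (i : Fin n) (f : Cfg σ n → ℝ) :
    sqNorm ν (Lop ν i f) = sqNorm ν f - sqNorm ν (Pop ν i f) := by
  have h : sqNorm ν (Lop ν i f) = sqNorm ν (Pop ν i f) +
      (sqNorm ν f + (-2) * expct ν (fun x => f x * Pop ν i f x)) := by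
    unfold sqNorm
    rw [← expct_const_mul, ← expct_add, ← expct_add]
    congr 1
    ext x
    simp only [Lop]
    ring
  rw [h, expct_mul_Pop_self hν]
  ring

theorem sqNorm_Lop_le {ν : Cfg σ n → ℝ} (hν : IsProb ν) (i : Fin n) (f : Cfg σ n → ℝ) :
    sqNorm ν (Lop ν i f) ≤ sqNorm ν f := by
  rw [sqNorm_Lop hν]
  linarith [sqNorm_nonneg hν (Pop ν i f)]

theorem absNorm_Pop_le {ν : Cfg σ n → ℝ} (hν : IsProb ν) (i : Fin n) (f : Cfg σ n → ℝ) :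
    absNorm ν (Pop ν i f) ≤ absNorm ν f := by
  unfold absNorm
  rw [← expct_Pop hν i (fun x => |f x|)]
  exact expct_mono hν fun x => abs_Pop_le hν i f x

theorem absNorm_Lop_le {ν : Cfg σ n → ℝ} (hν : IsProb ν) (i : Fin n) (f : Cfg σ n → ℝ) :
    absNorm ν (Lop ν i f) ≤ 2 * absNorm ν f := by
  have h := absNorm_sub_le hν (Pop ν i f) f
  have h' := absNorm_Pop_le hν i f
  have e : Lop ν i f = Pop ν i f - f := rfl
  rw [e]
  linarith

theorem dirichlet_abs_le {ν : Cfg σ n → ℝ} (hν : IsProb ν) (f : Cfg σ n → ℝ) :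
    dirichlet ν (fun x => |f x|) ≤ dirichlet ν f := by
  refine Finset.sum_le_sum fun i _ => ?_
  rw [sqNorm_Lop hν, sqNorm_Lop hν]
  have h1 : sqNorm ν (fun x => |f x|) = sqNorm ν f := by simp [sqNorm]
  have h2 : sqNorm ν (Pop ν i f) ≤ sqNorm ν (Pop ν i fun x => |f x|) :=
    expct_mono hν fun x => by
      rw [← sq_abs (Pop ν i f x)]
      exact pow_le_pow_left₀ (abs_nonneg _) (abs_Pop_le hν i f x) 2
  linarith

/-! ### Consequences of the log-Sobolev inequality -/

theorem mul_log_le_entFun_sq {ν : Cfg σ n → ℝ} (hν : IsProb ν) (u : Cfg σ n → ℝ)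
    (hm : 0 < absNorm ν u) (ha : 0 < sqNorm ν u) :
    sqNorm ν u * Real.log (sqNorm ν u / absNorm ν u ^ 2) ≤ entFun ν (fun x => u x ^ 2) := by
  set a := sqNorm ν u with ha'
  set m := absNorm ν u with hm'
  have hc : 0 < a / m := div_pos ha hm
  have key : a * Real.log (a / m) ≤ expct ν (fun x => u x ^ 2 * Real.log |u x|) := by
    have h : expct ν (fun x => Real.log (a / m) * u x ^ 2) ≤
        expct ν (fun x => (u x ^ 2 * Real.log |u x| + (a / m) * |u x|) + (-1) * u x ^ 2) := by
      refine expct_mono hν fun x => ?_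
      rcases eq_or_ne (u x) 0 with h0 | h0
      · simp [h0]
      have hx : 0 < |u x| := abs_pos.2 h0
      have hl := Real.log_le_sub_one_of_pos (div_pos hc hx)
      rw [Real.log_div hc.ne' hx.ne'] at hl
      have h2 := mul_le_mul_of_nonneg_left hl (sq_nonneg |u x|)
      have h3 : |u x| ^ 2 * (a / m / |u x| - 1) = (a / m) * |u x| - |u x| ^ 2 := by
        field_simp
      rw [h3, sq_abs] at h2
      nlinarith
    rw [expct_add, expct_add, expct_const_mul, expct_const_mul, expct_const_mul] at h
    have e1 : expct ν (fun x => u x ^ 2) = a := rfl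
    have e2 : expct ν (fun x => |u x|) = m := rfl
    rw [e1, e2, div_mul_cancel₀ _ hm.ne'] at h
    linarith
  have e : entFun ν (fun x => u x ^ 2) =
      2 * expct ν (fun x => u x ^ 2 * Real.log |u x|) - a * Real.log a := by
    unfold entFun
    rw [← expct_const_mul]
    congr 2
    ext x
    rw [Real.log_pow, Real.log_abs]
    push_cast
    ring
  rw [e]
  rw [Real.log_div ha.ne' hm.ne'] at key
  rw [Real.log_div ha.ne' (pow_pos hm 2).ne', Real.log_pow]
  push_cast
  linarith

theorem logSobolev_mul_log_le {ν : Cfg σ n → ℝ} (hν : IsProb ν) {ρ : ℝ} (hρ : 0 < ρ)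
    (hLS : LogSobolev ν ρ) (u : Cfg σ n → ℝ) (hm : 0 < absNorm ν u) (ha : 0 < sqNorm ν u) :
    ρ * (sqNorm ν u * Real.log (sqNorm ν u / absNorm ν u ^ 2)) ≤ 2 * dirichlet ν u := by
  refine (mul_le_mul_of_nonneg_left (mul_log_le_entFun_sq hν u hm ha) hρ.le).trans ?_
  refine (hLS (fun x => u x ^ 2) fun x => sq_nonneg _).trans ?_
  simp only [Real.sqrt_sq_eq_abs]
  exact mul_le_mul_of_nonneg_left (dirichlet_abs_le hν u) zero_le_two

theorem varnc_eq {ν : Cfg σ n → ℝ} (hν : IsProb ν) (f : Cfg σ n → ℝ) :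
    varnc ν f = sqNorm ν f - expct ν f ^ 2 := by
  have h : varnc ν f = sqNorm ν f + ((-2 * expct ν f) * expct ν f +
      expct ν (fun _ => expct ν f ^ 2)) := by
    unfold varnc sqNorm
    rw [← expct_const_mul, ← expct_add, ← expct_add]
    congr 1
    ext x
    ring
  rw [h, expct_const hν]
  ring

theorem varnc_add_const {ν : Cfg σ n → ℝ} (hν : IsProb ν) (f : Cfg σ n → ℝ) (c : ℝ) :
    varnc ν (fun x => f x + c) = varnc ν f := by
  unfold varnc
  rw [expct_add, expct_const hν]
  congr 1
  ext x
  ring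

theorem dirichlet_add_const {ν : Cfg σ n → ℝ} (hν : IsProb ν) (f : Cfg σ n → ℝ) (c : ℝ) :
    dirichlet ν (fun x => f x + c) = dirichlet ν f := by
  refine Finset.sum_congr rfl fun i _ => ?_
  congr 1
  have h : lopLin ν i (f + fun _ => c) = lopLin ν i f + lopLin ν i (fun _ => c) := map_add _ _ _
  have h0 : lopLin ν i (fun _ => c) = 0 := by
    rw [lopLin, LinearMap.sub_apply, popLin_apply, Pop_const hν]
    simp
  rw [h0, add_zero] at h
  exact h

/-- The Poincaré inequality. -/
theorem varnc_le_dirichlet {ν : Cfg σ n → ℝ} (hν : IsProb ν) {ρ : ℝ} (hρ : 0 < ρ)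
    (hLS : LogSobolev ν ρ) (f : Cfg σ n → ℝ) : ρ * varnc ν f ≤ 2 * dirichlet ν f := by
  have key : ∀ g : Cfg σ n → ℝ, (∀ x, 0 < g x) → ρ * varnc ν g ≤ 2 * dirichlet ν g := by
    intro g hg
    have hne : (Finset.univ : Finset (Cfg σ n)).Nonempty := by
      by_contra h
      rw [Finset.not_nonempty_iff_eq_empty] at h
      have := hν.2
      simp [h] at this
    have habs : absNorm ν g = expct ν g := by
      unfold absNorm
      congr 1
      ext x
      exact abs_of_pos (hg x)
    have hm : 0 < absNorm ν g := by
      rw [habs]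
      exact Finset.sum_pos (fun x _ => mul_pos (hν.1 x) (hg x)) hne
    have ha : 0 < sqNorm ν g :=
      Finset.sum_pos (fun x _ => mul_pos (hν.1 x) (pow_pos (hg x) 2)) hne
    refine le_trans (mul_le_mul_of_nonneg_left ?_ hρ.le) (logSobolev_mul_log_le hν hρ hLS g hm ha)
    rw [varnc_eq hν, ← habs]
    have hl := Real.one_sub_inv_le_log_of_pos (div_pos ha (pow_pos hm 2))
    have h2 := mul_le_mul_of_nonneg_left hl ha.le
    rw [inv_div] at h2
    have h3 : sqNorm ν g * (1 - absNorm ν g ^ 2 / sqNorm ν g) =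
        sqNorm ν g - absNorm ν g ^ 2 := by field_simp
    linarith
  have h := key (fun x => f x + (1 + ∑ y, |f y|)) fun x => by
    have h1 := Finset.single_le_sum (f := fun y => |f y|) (fun y _ => abs_nonneg _)
      (Finset.mem_univ x)
    have h2 := neg_abs_le (f x)
    linarith
  rwa [varnc_add_const hν, dirichlet_add_const hν] at h

/-! ### The discrete-time Glauber dynamics -/

/-- One step of the Glauber dynamics. -/
def glauber (ν : Cfg σ n → ℝ) : Module.End ℝ (Cfg σ n → ℝ) := (n : ℝ)⁻¹ • ∑ i, popLin ν i

theorem glauber_apply (ν f : Cfg σ n → ℝ) :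
    glauber ν f = (n : ℝ)⁻¹ • ∑ i, Pop ν i f := by
  simp [glauber, popLin_apply]

theorem absNorm_glauber_le {ν : Cfg σ n → ℝ} (hν : IsProb ν) (hn : 1 ≤ n) (f : Cfg σ n → ℝ) :
    absNorm ν (glauber ν f) ≤ absNorm ν f := by
  have hn' : (0 : ℝ) < n := by exact_mod_cast hn
  rw [glauber_apply, absNorm_smul, abs_of_pos (inv_pos.2 hn'), inv_mul_le_iff₀ hn']
  refine (absNorm_sum_le hν _ _).trans ?_
  refine (Finset.sum_le_sum fun i _ => absNorm_Pop_le hν i f).trans ?_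
  simp

theorem sum_sqNorm_Pop {ν : Cfg σ n → ℝ} (hν : IsProb ν) (f : Cfg σ n → ℝ) :
    ∑ i, sqNorm ν (Pop ν i f) = n * sqNorm ν f - dirichlet ν f := by
  simp [dirichlet, sqNorm_Lop hν]

theorem sqNorm_glauber_le {ν : Cfg σ n → ℝ} (hν : IsProb ν) (hn : 1 ≤ n) (f : Cfg σ n → ℝ) :
    sqNorm ν (glauber ν f) ≤ sqNorm ν f - (n : ℝ)⁻¹ * dirichlet ν f := by
  have hn' : (0 : ℝ) < n := by exact_mod_cast hn
  have h := sqNorm_sum_le hν Finset.univ fun i => Pop ν i f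
  rw [sum_sqNorm_Pop hν, Finset.card_univ, Fintype.card_fin] at h
  rw [glauber_apply, sqNorm_smul]
  calc ((n : ℝ)⁻¹) ^ 2 * sqNorm ν (∑ i, Pop ν i f)
      ≤ ((n : ℝ)⁻¹) ^ 2 * (n * (n * sqNorm ν f - dirichlet ν f)) :=
        mul_le_mul_of_nonneg_left h (sq_nonneg _)
    _ = _ := by field_simp

theorem sqNorm_le_sqNorm_glauber {ν : Cfg σ n → ℝ} (hν : IsProb ν) (hn : 1 ≤ n)
    (f : Cfg σ n → ℝ) :
    sqNorm ν f - 2 * ((n : ℝ)⁻¹ * dirichlet ν f) ≤ sqNorm ν (glauber ν f) := by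
  have hn' : (0 : ℝ) < n := by exact_mod_cast hn
  have h1 : expct ν (fun x => (2 * (n : ℝ)⁻¹) * (∑ i, f x * Pop ν i f x) + (-1) * f x ^ 2) ≤
      sqNorm ν (glauber ν f) := by
    refine expct_mono hν fun x => ?_
    rw [glauber_apply]
    simp only [Pi.smul_apply, Finset.sum_apply, smul_eq_mul, ← Finset.mul_sum]
    nlinarith [sq_nonneg ((n : ℝ)⁻¹ * ∑ i, Pop ν i f x - f x)]
  rw [expct_add, expct_const_mul, expct_const_mul, expct_sum] at h1
  simp only [expct_mul_Pop_self hν, sum_sqNorm_Pop hν] at h1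
  have e : expct ν (fun x => f x ^ 2) = sqNorm ν f := rfl
  rw [e] at h1
  have h2 : 2 * (n : ℝ)⁻¹ * (n * sqNorm ν f - dirichlet ν f) + (-1) * sqNorm ν f =
      sqNorm ν f - 2 * ((n : ℝ)⁻¹ * dirichlet ν f) := by
    field_simp
    ring
  linarith

theorem expct_glauber {ν : Cfg σ n → ℝ} (hν : IsProb ν) (hn : 1 ≤ n) (f : Cfg σ n → ℝ) :
    expct ν (glauber ν f) = expct ν f := by
  have hn' : (n : ℝ) ≠ 0 := by positivity
  have e : glauber ν f = fun x => (n : ℝ)⁻¹ * ∑ i, Pop ν i f x := by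
    rw [glauber_apply]
    ext x
    simp
  rw [e, expct_const_mul, expct_sum]
  simp [expct_Pop hν, hn']

/-- The variance is controlled by the energy dissipated in the first `n` steps. -/
theorem varnc_le_sum_dirichlet {ν : Cfg σ n → ℝ} (hν : IsProb ν) (hn : 1 ≤ n) {ρ : ℝ}
    (hρ : 0 < ρ) (hLS : LogSobolev ν ρ) (f : Cfg σ n → ℝ) :
    varnc ν f ≤ (2 / ρ + 2) *
      ((n : ℝ)⁻¹ * ∑ k ∈ Finset.range n, dirichlet ν ((glauber ν ^ k) f)) := by
  have hn' : (0 : ℝ) < n := by exact_mod_cast hn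
  set S := (n : ℝ)⁻¹ * ∑ k ∈ Finset.range n, dirichlet ν ((glauber ν ^ k) f) with hS
  have hdec : ∀ k, varnc ν f - 2 * ((n : ℝ)⁻¹ *
      ∑ l ∈ Finset.range k, dirichlet ν ((glauber ν ^ l) f)) ≤ varnc ν ((glauber ν ^ k) f) := by
    intro k
    induction k with
    | zero => simp
    | succ k ih =>
      rw [Finset.sum_range_succ, pow_succ', Module.End.mul_apply, varnc_eq hν (glauber ν _),
        expct_glauber hν hn]
      have h := sqNorm_le_sqNorm_glauber hν hn ((glauber ν ^ k) f)
      rw [varnc_eq hν ((glauber ν ^ k) f)] at ih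
      rw [mul_add]
      linarith
  have hle : ∀ k ∈ Finset.range n, varnc ν f - 2 * S ≤ varnc ν ((glauber ν ^ k) f) := by
    intro k hk
    refine le_trans ?_ (hdec k)
    have : ∑ l ∈ Finset.range k, dirichlet ν ((glauber ν ^ l) f) ≤
        ∑ l ∈ Finset.range n, dirichlet ν ((glauber ν ^ l) f) :=
      Finset.sum_le_sum_of_subset_of_nonneg
        (Finset.range_mono (Finset.mem_range.1 hk).le) fun _ _ _ => dirichlet_nonneg hν _
    have := mul_le_mul_of_nonneg_left this (inv_pos.2 hn').le
    rw [hS]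
    linarith
  have hsum : (n : ℝ) * (ρ * (varnc ν f - 2 * S)) ≤ 2 * (n * S) := by
    have h : ∑ k ∈ Finset.range n, ρ * (varnc ν f - 2 * S) ≤
        ∑ k ∈ Finset.range n, 2 * dirichlet ν ((glauber ν ^ k) f) :=
      Finset.sum_le_sum fun k hk =>
        (mul_le_mul_of_nonneg_left (hle k hk) hρ.le).trans (varnc_le_dirichlet hν hρ hLS _)
    rw [← Finset.mul_sum _ _ (2 : ℝ), Finset.sum_const, Finset.card_range, nsmul_eq_mul] at h
    have e : (n : ℝ) * S = ∑ k ∈ Finset.range n, dirichlet ν ((glauber ν ^ k) f) := by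
      rw [hS]
      field_simp
    rwa [e]
  have h2 : ρ * (varnc ν f - 2 * S) ≤ 2 * S := by
    refine le_of_mul_le_mul_left ?_ hn'
    linarith
  have h3 : (2 / ρ + 2) * S = (2 * S + ρ * (2 * S)) / ρ := by field_simp
  rw [h3, le_div_iff₀ hρ]
  linarith

/-! ### Commutation of the local operators -/

theorem Pop_comm {ν : Cfg σ n → ℝ} {G : SimpleGraph (Fin n)} (hG : IsMRF ν G) {i j : Fin n}
    (hij : ¬ G.Adj i j) (f : Cfg σ n → ℝ) :
    Pop ν i (Pop ν j f) = Pop ν j (Pop ν i f) := by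
  rcases eq_or_ne i j with rfl | hne
  · rfl
  have key : ∀ i j : Fin n, ¬ G.Adj i j → ∀ x : Cfg σ n, Pop ν i (Pop ν j f) x =
      ∑ a, ∑ c, condProb ν i x a * condProb ν j x c *
        f (Function.update (Function.update x i a) j c) := by
    intro i j hij x
    rw [Pop_eq_sum_condProb]
    refine Finset.sum_congr rfl fun a _ => ?_
    rw [Pop_eq_sum_condProb, Finset.mul_sum]
    refine Finset.sum_congr rfl fun c _ => ?_
    rw [hG j (Function.update x i a) x, mul_assoc]
    intro k hk
    have : k ≠ i := by
      rintro rfl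
      exact hij hk.symm
    simp [this]
  ext x
  rw [key i j hij, key j i (fun h => hij h.symm), Finset.sum_comm]
  refine Finset.sum_congr rfl fun c _ => Finset.sum_congr rfl fun a _ => ?_
  rw [Function.update_comm hne, mul_comm (condProb ν i x a)]

/-- The commutator of `Lop ν i` with the generator of the Glauber dynamics. -/
def glauberCommutator (ν : Cfg σ n → ℝ) (G : SimpleGraph (Fin n)) (i : Fin n) (f : Cfg σ n → ℝ) :
    Cfg σ n → ℝ :=
  ∑ j ∈ Finset.univ.filter (fun j => G.Adj i j), (Lop ν i (Lop ν j f) - Lop ν j (Lop ν i f))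

theorem Lop_glauber {ν : Cfg σ n → ℝ} {G : SimpleGraph (Fin n)} (hG : IsMRF ν G) (i : Fin n)
    (f : Cfg σ n → ℝ) :
    Lop ν i (glauber ν f) = glauber ν (Lop ν i f) + (n : ℝ)⁻¹ • glauberCommutator ν G i f := by
  have hcomm : ∀ j, lopLin ν i (lopLin ν j f) - lopLin ν j (lopLin ν i f) =
      popLin ν i (popLin ν j f) - popLin ν j (popLin ν i f) := by
    intro j
    simp only [lopLin, LinearMap.sub_apply, Module.End.one_apply, map_sub]
    abel
  have h1 : glauberCommutator ν G i f = ∑ j, (lopLin ν i (lopLin ν j f) - lopLin ν j (lopLin ν i f)) := by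
    unfold glauberCommutator
    rw [Finset.sum_filter]
    refine Finset.sum_congr rfl fun j _ => ?_
    split_ifs with h
    · rfl
    · rw [hcomm, popLin_apply, popLin_apply, popLin_apply, popLin_apply, Pop_comm hG h, sub_self]
  rw [h1, ← lopLin_apply, ← lopLin_apply]
  simp only [glauber, LinearMap.smul_apply, LinearMap.sum_apply, map_smul, map_sum]
  rw [← smul_add, ← Finset.sum_add_distrib]
  congr 1
  refine Finset.sum_congr rfl fun j _ => ?_
  simp only [lopLin, LinearMap.sub_apply, Module.End.one_apply, map_sub]
  abel

theorem absNorm_Lop_glauber_le {ν : Cfg σ n → ℝ} (hν : IsProb ν) (hn : 1 ≤ n)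
    {G : SimpleGraph (Fin n)} (hG : IsMRF ν G) (i : Fin n) (f : Cfg σ n → ℝ) :
    absNorm ν (Lop ν i (glauber ν f)) ≤ absNorm ν (Lop ν i f) + (n : ℝ)⁻¹ *
      ∑ j ∈ Finset.univ.filter (fun j => G.Adj i j),
        2 * (absNorm ν (Lop ν j f) + absNorm ν (Lop ν i f)) := by
  have hn' : (0 : ℝ) < n := by exact_mod_cast hn
  rw [Lop_glauber hG]
  refine (absNorm_add_le hν _ _).trans (add_le_add (absNorm_glauber_le hν hn _) ?_)
  rw [absNorm_smul, abs_of_pos (inv_pos.2 hn')]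
  refine mul_le_mul_of_nonneg_left ?_ (inv_pos.2 hn').le
  refine (absNorm_sum_le hν _ _).trans (Finset.sum_le_sum fun j _ => ?_)
  have h1 := absNorm_Lop_le hν i (Lop ν j f)
  have h2 := absNorm_Lop_le hν j (Lop ν i f)
  have h3 := absNorm_sub_le hν (Lop ν i (Lop ν j f)) (Lop ν j (Lop ν i f))
  linarith

theorem sqNorm_Lop_glauber_le {ν : Cfg σ n → ℝ} (hν : IsProb ν) (hn : 1 ≤ n)
    {G : SimpleGraph (Fin n)} (hG : IsMRF ν G) {Δ : ℕ} (hΔ : MaxDegLE G Δ) (i : Fin n)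
    (f : Cfg σ n → ℝ) :
    sqNorm ν (Lop ν i (glauber ν f)) + (n : ℝ)⁻¹ * dirichlet ν (Lop ν i f) ≤
      sqNorm ν (Lop ν i f) + (n : ℝ)⁻¹ * (sqNorm ν (Lop ν i f) +
        4 * Δ * ∑ j ∈ Finset.univ.filter (fun j => G.Adj i j),
          (sqNorm ν (Lop ν j f) + sqNorm ν (Lop ν i f))) := by
  have hn' : (0 : ℝ) < n := by exact_mod_cast hn
  have hε : (n : ℝ)⁻¹ ≤ 1 := inv_le_one_of_one_le₀ (by exact_mod_cast hn)
  have h1 := sqNorm_add_smul_le hν (glauber ν (Lop ν i f)) (glauberCommutator ν G i f)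
    (inv_pos.2 hn').le hε
  rw [← Lop_glauber hG] at h1
  have h2 := sqNorm_glauber_le hν hn (Lop ν i f)
  have h2' : sqNorm ν (glauber ν (Lop ν i f)) ≤ sqNorm ν (Lop ν i f) := by
    have := mul_nonneg (inv_pos.2 hn').le (dirichlet_nonneg hν (Lop ν i f))
    linarith
  have h3 : sqNorm ν (glauberCommutator ν G i f) ≤
      Δ * ∑ j ∈ Finset.univ.filter (fun j => G.Adj i j),
        2 * (sqNorm ν (Lop ν j f) + sqNorm ν (Lop ν i f)) := by
    refine (sqNorm_sum_le hν _ _).trans ?_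
    refine mul_le_mul (by exact_mod_cast hΔ i) (Finset.sum_le_sum fun j _ => ?_)
      (Finset.sum_nonneg fun j _ => sqNorm_nonneg hν _) (Nat.cast_nonneg _)
    refine (sqNorm_sub_le hν _ _).trans ?_
    have := sqNorm_Lop_le hν i (Lop ν j f)
    have := sqNorm_Lop_le hν j (Lop ν i f)
    linarith
  rw [← Finset.mul_sum] at h3
  have h4 : (n : ℝ)⁻¹ * (sqNorm ν (glauber ν (Lop ν i f)) + 2 * sqNorm ν (glauberCommutator ν G i f)) ≤
      (n : ℝ)⁻¹ * (sqNorm ν (Lop ν i f) +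
        4 * Δ * ∑ j ∈ Finset.univ.filter (fun j => G.Adj i j),
          (sqNorm ν (Lop ν j f) + sqNorm ν (Lop ν i f))) :=
    mul_le_mul_of_nonneg_left (by linarith) (inv_pos.2 hn').le
  linarith

theorem sqNorm_mul_one_sub_log_le {ν : Cfg σ n → ℝ} (hν : IsProb ν) {ρ : ℝ} (hρ : 0 < ρ)
    (hLS : LogSobolev ν ρ) (u : Cfg σ n → ℝ) {c J : ℝ} (hc : 0 ≤ c) (hJ0 : 0 ≤ J) (hJ1 : J ≤ 1)
    (h1 : absNorm ν u ≤ Real.exp c * J) (h2 : sqNorm ν u ≤ Real.exp c * J) :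
    sqNorm ν u * (1 - Real.log J) ≤
      4 / ρ * dirichlet ν u + (2 + (4 * c + 1) * Real.exp c) * J := by
  have hE : 0 ≤ 4 / ρ * dirichlet ν u := mul_nonneg (by positivity) (dirichlet_nonneg hν u)
  have hK : 0 ≤ (2 + (4 * c + 1) * Real.exp c) * J := by positivity
  rcases (sqNorm_nonneg hν u).eq_or_lt with ha | ha
  · rw [← ha]
    linarith
  have hJ : 0 < J := by
    rcases hJ0.eq_or_lt with h | h
    · rw [← h] at h2
      linarith
    · exact h
  have hm : 0 < absNorm ν u := by
    obtain ⟨x, -, hx⟩ := Finset.exists_lt_of_sum_lt (f := fun _ => (0 : ℝ))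
      (g := fun x => ν x * u x ^ 2) (s := Finset.univ) (by simpa [sqNorm, expct] using ha)
    have hx' : u x ≠ 0 := by
      rintro h
      simp [h] at hx
    exact Finset.sum_pos' (fun x _ => mul_nonneg (hν.1 x).le (abs_nonneg _))
      ⟨x, Finset.mem_univ x, mul_pos (hν.1 x) (abs_pos.2 hx')⟩
  have hS := logSobolev_mul_log_le hν hρ hLS u hm ha
  set a := sqNorm ν u
  set m := absNorm ν u
  set E := dirichlet ν u
  rw [Real.log_div ha.ne' (pow_pos hm 2).ne', Real.log_pow] at hS
  push_cast at hS
  have hlm : Real.log m ≤ c + Real.log J := by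
    have := Real.log_le_log hm h1
    rwa [Real.log_mul (Real.exp_pos c).ne' hJ.ne', Real.log_exp] at this
  have hlJ : Real.log J ≤ 0 := Real.log_nonpos hJ0 hJ1
  have hent : a * (3 / 2 * Real.log J - Real.log a) ≤ J := by
    have h := Real.add_one_le_exp (3 / 2 * Real.log J - Real.log a)
    rw [Real.exp_sub, Real.exp_log ha] at h
    have h' : Real.exp (3 / 2 * Real.log J) ≤ J := by
      calc Real.exp (3 / 2 * Real.log J) ≤ Real.exp (Real.log J) :=
            Real.exp_le_exp.2 (by linarith)
        _ = J := Real.exp_log hJ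
    have h3 := mul_le_mul_of_nonneg_left h ha.le
    rw [mul_div_cancel₀ _ ha.ne'] at h3
    linarith
  have hS' : a * (Real.log a - 2 * Real.log m) ≤ 2 / ρ * E := by
    rw [div_mul_eq_mul_div, le_div_iff₀ hρ]
    linarith
  have h4 := mul_le_mul_of_nonneg_left hlm ha.le
  have h5 := mul_le_mul_of_nonneg_left h2 (by positivity : (0 : ℝ) ≤ 4 * c + 1)
  have e : 4 / ρ * E = 2 * (2 / ρ * E) := by ring
  rw [e]
  linarith

/-! ### Majorants that vary slowly along the graph -/

theorem div_one_sub_log_mul_le {w x : ℝ} (hw0 : 0 ≤ w) (hw1 : w ≤ 1) (hx0 : 0 ≤ x)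
    (hx1 : x ≤ 1) : w * x / (1 - Real.log (w * x)) ≤ w * (x / (1 - Real.log x)) := by
  rcases hw0.eq_or_lt with rfl | hw
  · simp
  rcases hx0.eq_or_lt with rfl | hx
  · simp
  have h1 := Real.log_nonpos hw0 hw1
  have h2 := Real.log_nonpos hx0 hx1
  rw [← mul_div_assoc, Real.log_mul hw.ne' hx.ne']
  exact div_le_div_of_nonneg_left (by positivity) (by linarith) (by linarith)

theorem exists_slowly_varying_majorant {m : ℕ} {G : SimpleGraph (Fin m)} {Δ : ℕ} (hΔ : 1 ≤ Δ)
    (hG : MaxDegLE G Δ) (I : Fin m → ℝ) (hI0 : ∀ i, 0 ≤ I i) (hI1 : ∀ i, I i ≤ 1) :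
    ∃ J : Fin m → ℝ, (∀ i, I i ≤ J i) ∧ (∀ i, J i ≤ 1) ∧
      (∀ i j, G.Adj i j → J j ≤ 2 * Δ * J i) ∧
      ∑ i, J i / (1 - Real.log (J i)) ≤ 2 * ∑ i, I i / (1 - Real.log (I i)) := by
  have hΔ' : (1 : ℝ) ≤ Δ := by exact_mod_cast hΔ
  set θ : ℝ := (2 * (Δ : ℝ))⁻¹ with hθ
  have hθ0 : 0 < θ := by positivity
  have hθ1 : θ ≤ 1 := inv_le_one_of_one_le₀ (by linarith)
  have hθΔ : θ * Δ = 1 / 2 := by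
    rw [hθ]
    field_simp
  set W : Fin m → Fin m → ℝ := fun i j => if G.Reachable i j then θ ^ G.dist i j else 0 with hW
  have hW0 : ∀ i j, 0 ≤ W i j := by
    intro i j
    simp only [hW]
    split_ifs <;> positivity
  have hW1 : ∀ i j, W i j ≤ 1 := by
    intro i j
    simp only [hW]
    split_ifs
    · exact pow_le_one₀ hθ0.le hθ1
    · exact zero_le_one
  have hWadj : ∀ i k j, G.Adj i k → θ * W k j ≤ W i j := by
    intro i k j hik
    simp only [hW]
    by_cases h : G.Reachable k j
    · rw [if_pos h, if_pos (hik.reachable.trans h), ← pow_succ']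
      refine pow_le_pow_of_le_one hθ0.le hθ1 ?_
      obtain ⟨p, hp⟩ := h.exists_walk_length_eq_dist
      have := SimpleGraph.dist_le (SimpleGraph.Walk.cons hik p)
      rwa [SimpleGraph.Walk.length_cons, hp] at this
    · rw [if_neg h, if_neg (fun h' => h (hik.symm.reachable.trans h'))]
      simp
  have hWstep : ∀ i j, W i j ≤ (if i = j then 1 else 0) +
      θ * ∑ k, if G.Adj i k then W k j else 0 := by
    intro i j
    have hs : ∀ k, 0 ≤ if G.Adj i k then W k j else 0 := by
      intro k
      split_ifs
      · exact hW0 k j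
      · exact le_rfl
    have hS : 0 ≤ θ * ∑ k, if G.Adj i k then W k j else 0 :=
      mul_nonneg hθ0.le (Finset.sum_nonneg fun k _ => hs k)
    by_cases hij : i = j
    · rw [if_pos hij]
      linarith [hW1 i j]
    rw [if_neg hij, zero_add]
    by_cases h : G.Reachable i j
    · obtain ⟨p, hp⟩ := h.exists_walk_length_eq_dist
      cases p with
      | nil => exact absurd rfl hij
      | @cons _ k _ hik p =>
        rw [SimpleGraph.Walk.length_cons] at hp
        have hk : W i j ≤ θ * W k j := by
          simp only [hW]
          rw [if_pos h, if_pos p.reachable, ← pow_succ', ← hp]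
          refine pow_le_pow_of_le_one hθ0.le hθ1 ?_
          have := SimpleGraph.dist_le p
          omega
        refine hk.trans (mul_le_mul_of_nonneg_left ?_ hθ0.le)
        have := Finset.single_le_sum (f := fun k => if G.Adj i k then W k j else 0)
          (fun k _ => hs k) (Finset.mem_univ k)
        simpa [hik] using this
    · refine le_trans ?_ hS
      simp only [hW]
      rw [if_neg h]
  have hWsum : ∀ j, ∑ i, W i j ≤ 2 := by
    intro j
    have h1 : ∑ i, W i j ≤ 1 + θ * ∑ i, ∑ k, (if G.Adj i k then W k j else 0) := by
      refine (Finset.sum_le_sum fun i _ => hWstep i j).trans ?_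
      rw [Finset.sum_add_distrib, ← Finset.mul_sum]
      simp
    have h2 : ∑ i, ∑ k, (if G.Adj i k then W k j else 0) ≤ Δ * ∑ k, W k j := by
      rw [Finset.sum_comm, Finset.mul_sum]
      refine Finset.sum_le_sum fun k _ => ?_
      rw [← Finset.sum_filter, Finset.sum_const, nsmul_eq_mul]
      refine mul_le_mul_of_nonneg_right ?_ (hW0 k j)
      have := hG k
      simp only [G.adj_comm k] at this
      exact_mod_cast this
    have h3 := mul_le_mul_of_nonneg_left h2 hθ0.le
    rw [← mul_assoc, hθΔ] at h3
    linarith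
  have hmax : ∀ i, ∃ j, ∀ k, W i k * I k ≤ W i j * I j := by
    intro i
    obtain ⟨j, -, hj⟩ := Finset.exists_max_image Finset.univ (fun k => W i k * I k)
      ⟨i, Finset.mem_univ i⟩
    exact ⟨j, fun k => hj k (Finset.mem_univ k)⟩
  choose t ht using hmax
  have hΦ : ∀ j, 0 ≤ I j / (1 - Real.log (I j)) := fun j =>
    div_nonneg (hI0 j) (by linarith [Real.log_nonpos (hI0 j) (hI1 j)])
  refine ⟨fun i => W i (t i) * I (t i), fun i => ?_, fun i => ?_, fun i j hij => ?_, ?_⟩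
  · refine le_trans ?_ (ht i i)
    simp [hW]
  · exact mul_le_one₀ (hW1 _ _) (hI0 _) (hI1 _)
  · have h1 := mul_le_mul_of_nonneg_right (hWadj i j (t j) hij) (hI0 (t j))
    have h2 := h1.trans (ht i (t j))
    have h3 := mul_le_mul_of_nonneg_left h2 (by positivity : (0 : ℝ) ≤ 2 * Δ)
    have e : 2 * (Δ : ℝ) * (θ * W j (t j) * I (t j)) = W j (t j) * I (t j) := by
      rw [hθ]
      field_simp
    rwa [e] at h3
  · calc ∑ i, W i (t i) * I (t i) / (1 - Real.log (W i (t i) * I (t i)))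
        ≤ ∑ i, ∑ j, W i j * (I j / (1 - Real.log (I j))) := by
          refine Finset.sum_le_sum fun i _ => ?_
          refine (div_one_sub_log_mul_le (hW0 _ _) (hW1 _ _) (hI0 _) (hI1 _)).trans ?_
          exact Finset.single_le_sum (f := fun j => W i j * (I j / (1 - Real.log (I j))))
            (fun j _ => mul_nonneg (hW0 i j) (hΦ j)) (Finset.mem_univ (t i))
      _ = ∑ j, (∑ i, W i j) * (I j / (1 - Real.log (I j))) := by
          rw [Finset.sum_comm]
          simp only [Finset.sum_mul]
      _ ≤ ∑ j, 2 * (I j / (1 - Real.log (I j))) :=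
          Finset.sum_le_sum fun j _ => mul_le_mul_of_nonneg_right (hWsum j) (hΦ j)
      _ = _ := by rw [Finset.mul_sum]

/-- A discrete Grönwall inequality along the graph, with dissipation `e`. -/
theorem gronwall_along_graph {m : ℕ} (hm : 1 ≤ m) {G : SimpleGraph (Fin m)} {Δ : ℕ}
    (hG : MaxDegLE G Δ) {J : Fin m → ℝ} (hJ0 : ∀ i, 0 ≤ J i)
    (hJ : ∀ i j, G.Adj i j → J j ≤ 2 * Δ * J i) {D : ℝ} (hD : 0 ≤ D) {z e : ℕ → Fin m → ℝ}
    (hz : ∀ k i, 0 ≤ z k i) (he : ∀ k i, 0 ≤ e k i) (hinit : ∀ i, z 0 i ≤ J i)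
    (hstep : ∀ k i, z (k + 1) i + (m : ℝ)⁻¹ * e k i ≤ z k i + (m : ℝ)⁻¹ *
      (D * (z k i + ∑ j ∈ Finset.univ.filter (fun j => G.Adj i j), z k j)))
    {c : ℝ} (hc : c = D * (1 + 2 * Δ ^ 2)) :
    (∀ k ≤ m, ∀ i, z k i ≤ Real.exp c * J i) ∧
      ∀ i, (m : ℝ)⁻¹ * ∑ k ∈ Finset.range m, e k i ≤ (1 + c * Real.exp c) * J i := by
  have hm' : (0 : ℝ) < m := by exact_mod_cast hm
  set ε := (m : ℝ)⁻¹ with hε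
  have hε0 : 0 < ε := inv_pos.2 hm'
  have hc0 : 0 ≤ c := by
    rw [hc]
    positivity
  have hinc : ∀ {k : ℕ} {M : ℝ}, 0 ≤ M → (∀ i, z k i ≤ M * J i) → ∀ i,
      D * (z k i + ∑ j ∈ Finset.univ.filter (fun j => G.Adj i j), z k j) ≤ c * (M * J i) := by
    intro k M hM hk i
    have hs : ∑ j ∈ Finset.univ.filter (fun j => G.Adj i j), z k j ≤
        Δ * (M * (2 * Δ * J i)) := by
      have hnn : 0 ≤ M * (2 * Δ * J i) := by
        have := hJ0 i
        positivity
      calc ∑ j ∈ Finset.univ.filter (fun j => G.Adj i j), z k j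
          ≤ ∑ j ∈ Finset.univ.filter (fun j => G.Adj i j), M * (2 * Δ * J i) := by
            refine Finset.sum_le_sum fun j hj => (hk j).trans ?_
            exact mul_le_mul_of_nonneg_left (hJ i j (Finset.mem_filter.1 hj).2) hM
        _ ≤ Δ * (M * (2 * Δ * J i)) := by
            rw [Finset.sum_const, nsmul_eq_mul]
            exact mul_le_mul_of_nonneg_right (by exact_mod_cast hG i) hnn
    calc _ ≤ D * (M * J i + Δ * (M * (2 * Δ * J i))) :=
          mul_le_mul_of_nonneg_left (add_le_add (hk i) hs) hD
      _ = c * (M * J i) := by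
          rw [hc]
          ring
  have hexp : ∀ k i, z k i ≤ Real.exp (ε * c * k) * J i := by
    intro k
    induction k with
    | zero => simpa using hinit
    | succ k ih =>
      intro i
      have h1 := hinc (Real.exp_pos _).le ih i
      have h2 := mul_le_mul_of_nonneg_left h1 hε0.le
      have h3 := hstep k i
      have h4 := mul_nonneg hε0.le (he k i)
      have h5 : Real.exp (ε * c * (k + 1 : ℕ)) = Real.exp (ε * c * k) * Real.exp (ε * c) := by
        rw [← Real.exp_add]
        push_cast
        ring_nf
      have h6 := mul_le_mul_of_nonneg_left (Real.add_one_le_exp (ε * c))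
        (mul_nonneg (Real.exp_pos (ε * c * k)).le (hJ0 i))
      rw [h5]
      linarith [ih i]
  have hbd : ∀ k ≤ m, ∀ i, z k i ≤ Real.exp c * J i := by
    intro k hk i
    refine (hexp k i).trans (mul_le_mul_of_nonneg_right (Real.exp_le_exp.2 ?_) (hJ0 i))
    have hk' : ε * k ≤ 1 := by
      rw [hε, inv_mul_le_iff₀ hm', mul_one]
      exact_mod_cast hk
    nlinarith
  refine ⟨hbd, fun i => ?_⟩
  have htel : ∀ k ≤ m, z k i + ε * ∑ l ∈ Finset.range k, e l i ≤
      J i + ε * k * (c * (Real.exp c * J i)) := by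
    intro k
    induction k with
    | zero => simpa using hinit i
    | succ k ih =>
      intro hk
      have h1 := ih (by omega)
      have h2 := mul_le_mul_of_nonneg_left
        (hinc (Real.exp_pos c).le (hbd k (by omega)) i) hε0.le
      have h3 := hstep k i
      rw [Finset.sum_range_succ]
      push_cast
      linarith
  have h := htel m le_rfl
  rw [hε, inv_mul_cancel₀ hm'.ne', ← hε] at h
  linarith [hz m i]

/-! ### Influences -/

theorem abs_Lop_le_indicator {ν : Cfg σ n → ℝ} (hν : IsProb ν) {f : Cfg σ n → ℝ}
    (hf : ∀ x, f x = 0 ∨ f x = 1) (i : Fin n) (x : Cfg σ n) :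
    |Lop ν i f x| ≤ if ∃ a : σ, f (Function.update x i a) ≠ f x then 1 else 0 := by
  split_ifs with h
  · have h0 : ∀ y, 0 ≤ f y := fun y => by rcases hf y with h | h <;> simp [h]
    have h1 : ∀ y, f y ≤ 1 := fun y => by rcases hf y with h | h <;> simp [h]
    have hl := Pop_mono hν i h0 x
    have hu := Pop_mono hν i h1 x
    rw [Pop_const hν] at hl hu
    rw [Lop, abs_le]
    constructor <;> linarith [h0 x, h1 x]
  · push Not at h
    rw [Lop, Pop_eq, sum_fibre]
    simp only [h]
    rw [← Finset.sum_mul, ← sum_fibre, mul_div_right_comm, div_self (sum_fibre_pos hν i x).ne']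
    simp

theorem influence_eq_expct (ν f : Cfg σ n → ℝ) (i : Fin n) : influence ν f i =
    expct ν (fun x => if ∃ a : σ, f (Function.update x i a) ≠ f x then 1 else 0) := by
  unfold influence expct
  rw [Finset.sum_filter]
  simp

theorem absNorm_Lop_le_influence {ν : Cfg σ n → ℝ} (hν : IsProb ν) {f : Cfg σ n → ℝ}
    (hf : ∀ x, f x = 0 ∨ f x = 1) (i : Fin n) : absNorm ν (Lop ν i f) ≤ influence ν f i := by
  rw [influence_eq_expct]
  exact expct_mono hν (abs_Lop_le_indicator hν hf i)

theorem sqNorm_Lop_le_influence {ν : Cfg σ n → ℝ} (hν : IsProb ν) {f : Cfg σ n → ℝ}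
    (hf : ∀ x, f x = 0 ∨ f x = 1) (i : Fin n) : sqNorm ν (Lop ν i f) ≤ influence ν f i := by
  rw [influence_eq_expct]
  refine expct_mono hν fun x => ?_
  have h := abs_Lop_le_indicator hν hf i x
  rw [← sq_abs]
  refine (pow_le_pow_left₀ (abs_nonneg _) h 2).trans_eq ?_
  split_ifs <;> simp

theorem influence_nonneg {ν : Cfg σ n → ℝ} (hν : IsProb ν) (f : Cfg σ n → ℝ) (i : Fin n) :
    0 ≤ influence ν f i :=
  Finset.sum_nonneg fun x _ => (hν.1 x).le

theorem influence_le_one {ν : Cfg σ n → ℝ} (hν : IsProb ν) (f : Cfg σ n → ℝ) (i : Fin n) :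
    influence ν f i ≤ 1 := by
  rw [← hν.2]
  exact Finset.sum_le_sum_of_subset_of_nonneg (Finset.filter_subset _ _) fun x _ _ => (hν.1 x).le

/-- Talagrand's inequality with the logarithms of the influences themselves. -/
theorem varnc_le_sum_influence_div_log {ν : Cfg σ n → ℝ} (hν : IsProb ν) (hn : 1 ≤ n) {ρ : ℝ}
    (hρ : 0 < ρ) (hLS : LogSobolev ν ρ) {G : SimpleGraph (Fin n)} (hG : IsMRF ν G) {Δ : ℕ}
    (hΔ : 1 ≤ Δ) (hdeg : MaxDegLE G Δ) {f : Cfg σ n → ℝ} (hf : ∀ x, f x = 0 ∨ f x = 1)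
    {c : ℝ} (hc : c = (1 + 4 * (Δ : ℝ) ^ 2) * (1 + 2 * Δ ^ 2)) :
    varnc ν f ≤ 2 * (2 / ρ + 2) *
      (4 / ρ * (1 + c * Real.exp c) + (2 + (4 * c + 1) * Real.exp c)) *
        ∑ j, influence ν f j / (1 - Real.log (influence ν f j)) := by
  have hn' : (0 : ℝ) < n := by exact_mod_cast hn
  have hΔ' : (1 : ℝ) ≤ Δ := by exact_mod_cast hΔ
  have hc0 : 0 ≤ c := by
    rw [hc]
    positivity
  obtain ⟨J, hIJ, hJ1, hJadj, hJsum⟩ := exists_slowly_varying_majorant hΔ hdeg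
    (influence ν f) (influence_nonneg hν f) (influence_le_one hν f)
  have hJ0 : ∀ i, 0 ≤ J i := fun i => (influence_nonneg hν f i).trans (hIJ i)
  set F : ℕ → Cfg σ n → ℝ := fun k => (glauber ν ^ k) f with hF
  have hFsucc : ∀ k, F (k + 1) = glauber ν (F k) := by
    intro k
    simp only [hF, pow_succ', Module.End.mul_apply]
  have hF0 : F 0 = f := by simp [hF]
  have hsq : ∀ k i, 0 ≤ sqNorm ν (Lop ν i (F k)) := fun k i => sqNorm_nonneg hν _
  have habs : ∀ k i, 0 ≤ absNorm ν (Lop ν i (F k)) := fun k i => absNorm_nonneg hν _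
  have hcard : ∀ i, ((Finset.univ.filter fun j => G.Adj i j).card : ℝ) ≤ Δ := fun i => by
    exact_mod_cast hdeg i
  obtain ⟨hm, -⟩ := gronwall_along_graph (z := fun k i => absNorm ν (Lop ν i (F k)))
    (e := fun _ _ => 0) (D := 1 + 4 * (Δ : ℝ) ^ 2) hn hdeg hJ0 hJadj (by positivity) habs
    (fun _ _ => le_rfl)
    (fun i => by
      rw [hF0]
      exact (absNorm_Lop_le_influence hν hf i).trans (hIJ i))
    (fun k i => by
      rw [hFsucc]
      have h := absNorm_Lop_glauber_le hν hn hG i (F k)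
      rw [mul_zero, add_zero]
      refine h.trans (add_le_add_right (mul_le_mul_of_nonneg_left ?_ (inv_pos.2 hn').le) _)
      rw [← Finset.mul_sum, Finset.sum_add_distrib, Finset.sum_const, nsmul_eq_mul]
      have h0 := habs k i
      have hs := Finset.sum_nonneg fun j (_ : j ∈ Finset.univ.filter fun j => G.Adj i j) =>
        habs k j
      have h1 := mul_le_mul_of_nonneg_right (hcard i) h0
      nlinarith [mul_nonneg (sq_nonneg ((Δ : ℝ) - 1)) h0, mul_nonneg (sq_nonneg (Δ : ℝ)) h0,
        mul_nonneg (by nlinarith : (0 : ℝ) ≤ 4 * (Δ : ℝ) ^ 2 - 1) hs]) hc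
  obtain ⟨ha, hE⟩ := gronwall_along_graph (z := fun k i => sqNorm ν (Lop ν i (F k)))
    (e := fun k i => dirichlet ν (Lop ν i (F k))) (D := 1 + 4 * (Δ : ℝ) ^ 2) hn hdeg hJ0 hJadj
    (by positivity) hsq (fun _ _ => dirichlet_nonneg hν _)
    (fun i => by
      rw [hF0]
      exact (sqNorm_Lop_le_influence hν hf i).trans (hIJ i))
    (fun k i => by
      rw [hFsucc]
      refine (sqNorm_Lop_glauber_le hν hn hG hdeg i (F k)).trans
        (add_le_add_right (mul_le_mul_of_nonneg_left ?_ (inv_pos.2 hn').le) _)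
      rw [Finset.sum_add_distrib, Finset.sum_const, nsmul_eq_mul]
      have h0 := hsq k i
      have hs := Finset.sum_nonneg fun j (_ : j ∈ Finset.univ.filter fun j => G.Adj i j) =>
        hsq k j
      have h1 := mul_le_mul_of_nonneg_left (mul_le_mul_of_nonneg_right (hcard i) h0)
        (by positivity : (0 : ℝ) ≤ 4 * Δ)
      nlinarith [mul_nonneg (by nlinarith : (0 : ℝ) ≤ 1 + 4 * (Δ : ℝ) ^ 2 - 4 * Δ) hs]) hc
  set K := 4 / ρ * (1 + c * Real.exp c) + (2 + (4 * c + 1) * Real.exp c) with hK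
  have hK0 : 0 ≤ K := by positivity
  have hcoord : ∀ i, (n : ℝ)⁻¹ * ∑ k ∈ Finset.range n, sqNorm ν (Lop ν i (F k)) ≤
      K * (J i / (1 - Real.log (J i))) := by
    intro i
    have hl : 0 < 1 - Real.log (J i) := by linarith [Real.log_nonpos (hJ0 i) (hJ1 i)]
    rw [← mul_div_assoc, le_div_iff₀ hl, mul_assoc, Finset.sum_mul]
    have h : ∑ k ∈ Finset.range n, sqNorm ν (Lop ν i (F k)) * (1 - Real.log (J i)) ≤
        ∑ k ∈ Finset.range n, (4 / ρ * dirichlet ν (Lop ν i (F k)) +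
          (2 + (4 * c + 1) * Real.exp c) * J i) := by
      refine Finset.sum_le_sum fun k hk => ?_
      have hk := (Finset.mem_range.1 hk).le
      exact sqNorm_mul_one_sub_log_le hν hρ hLS _ hc0 (hJ0 i) (hJ1 i) (hm k hk i) (ha k hk i)
    rw [Finset.sum_add_distrib, ← Finset.mul_sum, Finset.sum_const, Finset.card_range,
      nsmul_eq_mul] at h
    have h2 := mul_le_mul_of_nonneg_left h (inv_pos.2 hn').le
    rw [mul_add, inv_mul_cancel_left₀ hn'.ne'] at h2
    have h3 := mul_le_mul_of_nonneg_left (hE i) (by positivity : 0 ≤ 4 / ρ)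
    rw [hK]
    linarith
  have htot : (n : ℝ)⁻¹ * ∑ k ∈ Finset.range n, dirichlet ν (F k) ≤
      K * (2 * ∑ j, influence ν f j / (1 - Real.log (influence ν f j))) := by
    calc (n : ℝ)⁻¹ * ∑ k ∈ Finset.range n, dirichlet ν (F k)
        = ∑ i, (n : ℝ)⁻¹ * ∑ k ∈ Finset.range n, sqNorm ν (Lop ν i (F k)) := by
          unfold dirichlet
          rw [Finset.sum_comm, Finset.mul_sum]
      _ ≤ ∑ i, K * (J i / (1 - Real.log (J i))) := Finset.sum_le_sum fun i _ => hcoord i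
      _ ≤ _ := by
          rw [← Finset.mul_sum]
          exact mul_le_mul_of_nonneg_left hJsum hK0
  have h1 := varnc_le_sum_dirichlet hν hn hρ hLS f
  have h2 := mul_le_mul_of_nonneg_left htot (by positivity : 0 ≤ 2 / ρ + 2)
  linarith

/-- **Talagrand inequality in terms of influences** (equation (10) in the paper).
For all `b ≥ 1`, `ρ ∈ (0,1]`, `Δ ≥ 1`, `q ≥ 2` there is `C = C(b,ρ,Δ,q) > 0` such that for
every `n ≥ 1`, alphabet of size `q`, `ν` satisfying Assumption A, and `f : Σ^n → {0,1}` with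
`bq√(I_j(f)) ≤ 1` for all `j`:
`Var_ν(f) ≤ C ∑_j I_j(f)/(1 - log(bq√(I_j(f))))`, terms with `I_j(f) = 0` interpreted as `0`. -/
theorem talagrand_influences (b ρ : ℝ) (Δ q : ℕ) (hb : 1 ≤ b) (hρ0 : 0 < ρ) (hρ1 : ρ ≤ 1)
    (hΔ : 1 ≤ Δ) (hq : 2 ≤ q) :
    ∃ C : ℝ, 0 < C ∧
      ∀ (n : ℕ), 1 ≤ n →
        ∀ (σ : Type) [Fintype σ] [DecidableEq σ], Fintype.card σ = q →
          ∀ ν : Cfg σ n → ℝ, AssumptionA ν b ρ Δ →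
            ∀ f : Cfg σ n → ℝ, (∀ x, f x = 0 ∨ f x = 1) →
              (∀ j : Fin n, b * (q : ℝ) * Real.sqrt (influence ν f j) ≤ 1) →
              varnc ν f ≤
                C * ∑ j : Fin n,
                  (if influence ν f j = 0 then 0
                   else influence ν f j /
                     (1 - Real.log (b * (q : ℝ) * Real.sqrt (influence ν f j)))) := by
  obtain ⟨c, hc⟩ : ∃ c : ℝ, c = (1 + 4 * (Δ : ℝ) ^ 2) * (1 + 2 * Δ ^ 2) := ⟨_, rfl⟩
  have hc0 : 0 ≤ c := by
    rw [hc]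
    positivity
  refine ⟨2 * (2 / ρ + 2) * (4 / ρ * (1 + c * Real.exp c) + (2 + (4 * c + 1) * Real.exp c)),
    by positivity, ?_⟩
  intro n hn σ _ _ _ ν hA f hf hsmall
  obtain ⟨hν, -, -, -, -, hLS, G, hG, hdeg⟩ := hA
  refine (varnc_le_sum_influence_div_log hν hn hρ0 hLS hG hΔ hdeg hf hc).trans
    (mul_le_mul_of_nonneg_left (Finset.sum_le_sum fun j _ => ?_) (by positivity))
  split_ifs with h0
  · simp [h0]
  have hI : 0 < influence ν f j := lt_of_le_of_ne (influence_nonneg hν f j) (Ne.symm h0)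
  have hq' : (1 : ℝ) ≤ q := by exact_mod_cast (by omega : 1 ≤ q)
  have hbq : 1 ≤ b * q := one_le_mul_of_one_le_of_one_le hb hq'
  have hs : 0 < Real.sqrt (influence ν f j) := Real.sqrt_pos.2 hI
  have hlog : Real.log (b * q * Real.sqrt (influence ν f j)) ≤ 0 :=
    Real.log_nonpos (by positivity) (hsmall j)
  have hle : Real.log (influence ν f j) ≤ Real.log (b * q * Real.sqrt (influence ν f j)) := by
    refine Real.log_le_log hI ?_
    have h1 : Real.sqrt (influence ν f j) ≤ 1 :=
      Real.sqrt_le_one.2 (influence_le_one hν f j)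
    nlinarith [Real.mul_self_sqrt hI.le]
  exact div_le_div_of_nonneg_left hI.le (by linarith) (by linarith)
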